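/- arXiv:1505.02500 — 2 statements merged into one kernel-verified Lean document; each statement's English description precedes it below -/
import Mathlib

section
/- Let X be a finite set and f : X → X a function with no fixed points. Then there exists a colouring ν : X → {0,1,2} such that for all x, y ∈ X, if ν(x) = ν(y) then f(x) ≠ y. -/
/-- In a nonempty finite set, some element has at most one preimage from the set. -/
theorem Finset.Nonempty.exists_preimage_unique {X : Type*} (f : X → X) {S : Finset X}
    (hS : S.Nonempty) : ∃ v ∈ S, ∃ p, ∀ x ∈ S, f x = v → x = p := by
  classical
  obtain ⟨v, hv⟩ := hS
  by_cases h : S ⊆ S.image f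
  · have hinj : Set.InjOn f S := Finset.card_image_iff.mp
      (le_antisymm Finset.card_image_le (Finset.card_le_card h))
    obtain ⟨p, hp, hpv⟩ := Finset.mem_image.mp (h hv)
    exact ⟨v, hv, p, fun x hx hxv => hinj hx hp (hxv.trans hpv.symm)⟩
  · obtain ⟨w, hw, hwS⟩ := Finset.not_subset.mp h
    exact ⟨w, hw, w, fun x hx hxw => (hwS (Finset.mem_image.mpr ⟨x, hx, hxw⟩)).elim⟩

/-- A fixed-point-free self-map admits a proper 3-colouring on every finite set. -/
theorem Finset.exists_three_colouring {X : Type*} (f : X → X) (hf : ∀ x, f x ≠ x)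
    (S : Finset X) : ∃ ν : X → Fin 3, ∀ x ∈ S, f x ∈ S → ν x ≠ ν (f x) := by
  classical
  induction S using Finset.strongInduction with
  | H S ih =>
    rcases S.eq_empty_or_nonempty with rfl | hS
    · exact ⟨fun _ => 0, by simp⟩
    obtain ⟨v, hv, p, hp⟩ := hS.exists_preimage_unique f
    obtain ⟨ν, hν⟩ := ih (S.erase v) (Finset.erase_ssubset hv)
    have third_colour : ∀ a b : Fin 3, ∃ c, c ≠ a ∧ c ≠ b := by decide
    obtain ⟨c, hc, hcp⟩ := third_colour (ν (f v)) (ν p)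
    refine ⟨Function.update ν v c, fun x hx hfx => ?_⟩
    by_cases hxv : x = v
    · subst hxv
      simpa [Function.update_of_ne (hf x)] using hc
    by_cases hfv : f x = v
    · rw [hfv, Function.update_self, Function.update_of_ne hxv, hp x hx hfv]
      exact hcp.symm
    · rw [Function.update_of_ne hxv, Function.update_of_ne hfv]
      exact hν x (Finset.mem_erase.mpr ⟨hxv, hx⟩) (Finset.mem_erase.mpr ⟨hfv, hfx⟩)

theorem stmt_0 {X : Type*} [Finite X] (f : X → X) (hf : ∀ x, f x ≠ x) :
    ∃ ν : X → Fin 3, ∀ x y : X, ν x = ν y → f x ≠ y := by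
  cases nonempty_fintype X
  obtain ⟨ν, hν⟩ := Finset.exists_three_colouring f hf Finset.univ
  exact ⟨ν, fun x y hxy hfx =>
    hν x (Finset.mem_univ _) (Finset.mem_univ _) (hfx.symm ▸ hxy)⟩
end

section
/- Let k ≥ 2 and n < ω. Then there is a colouring of G(ω_n) = ⊕_{σ<ω_n} ℚ using 2^{4+n}·3^2 colours such that there is no infinite subset X of G(ω_n) for which FS_k(X) ∪ {k·x : x ∈ X} is monochromatic. -/
open Cardinal

/-- `G κ` is the direct sum of `κ` copies of `ℚ`. -/
def G (κ : Cardinal) : Type _ := κ.out →₀ ℚ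

noncomputable instance (κ : Cardinal) : AddCommGroup (G κ) := Finsupp.instAddCommGroup

/-- Sums of `k` distinct elements of `X`. -/
def FS {α : Type*} [AddCommMonoid α] (k : ℕ) (X : Set α) : Set α :=
  {y | ∃ F : Finset α, ↑F ⊆ X ∧ F.card = k ∧ y = ∑ x ∈ F, x}


/-- A colouring `c` separates sums if every infinite set `X` contains `k` distinct elements whose
sum has a colour different from that of `k • y`, for some `y` among them. -/
def SeparatesSums (k : ℕ) {A C : Type*} [AddCommMonoid A] (c : A → C) : Prop :=
  ∀ X : Set A, X.Infinite → ∃ F : Finset A, ↑F ⊆ X ∧ F.card + 1 = k ∧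
    ∃ y ∈ X, y ∉ F ∧ c (y + ∑ x ∈ F, x) ≠ c (k • y)

theorem SeparatesSums.comp_injective {k : ℕ} {A C D : Type*} [AddCommMonoid A] {c : A → C}
    (hc : SeparatesSums k c) {g : C → D} (hg : Function.Injective g) :
    SeparatesSums k (g ∘ c) := by
  intro X hX
  obtain ⟨F, hFX, hF, y, hy, hyF, h⟩ := hc X hX
  exact ⟨F, hFX, hF, y, hy, hyF, fun e => h (hg e)⟩

theorem SeparatesSums.exists_fin {k : ℕ} {A C : Type*} [AddCommMonoid A] [Fintype C] {c : A → C}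
    (hc : SeparatesSums k c) {N : ℕ} (hN : Fintype.card C ≤ N) :
    ∃ c' : A → Fin N, SeparatesSums k c' :=
  ⟨_, hc.comp_injective
    ((Fin.castLE_injective hN).comp (Fintype.equivFin C).injective)⟩

theorem SeparatesSums.not_exists_monochromatic {k : ℕ} {A C : Type*} [AddCommMonoid A] {c : A → C}
    (hc : SeparatesSums k c) :
    ¬ ∃ X : Set A, X.Infinite ∧ ∃ i, ∀ y ∈ FS k X ∪ (fun x => k • x) '' X, c y = i := by
  classical
  rintro ⟨X, hX, i, h⟩
  obtain ⟨F, hFX, hF, y, hy, hyF, hne⟩ := hc X hX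
  refine hne ((h _ (Or.inl ⟨insert y F, ?_, ?_, ?_⟩)).trans (h _ (Or.inr ⟨y, hy, rfl⟩)).symm)
  · simpa [Set.insert_subset_iff] using ⟨hy, hFX⟩
  · rw [Finset.card_insert_of_notMem hyF, hF]
  · rw [Finset.sum_insert hyF]

/-- Every self-map with finite orbits admits a `3`-colouring in which each non-fixed point has a
colour different from that of its image. -/
theorem exists_three_colouring {A : Type*} (f : A → A)
    (hfin : ∀ x, (Set.range fun n : ℕ => f^[n] x).Finite) :
    ∃ col : A → Fin 3, ∀ x, f x ≠ x → col x ≠ col (f x) := by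
  classical
  let S : A → Set A := fun x => {a | ∃ᶠ n in Filter.atTop, f^[n] x = a}
  have hS : ∀ x, S (f x) = S x := by
    intro x
    ext a
    simp only [S, Set.mem_ofPred_eq, Filter.frequently_atTop]
    constructor
    · intro h m
      obtain ⟨n, hn, e⟩ := h m
      exact ⟨n + 1, by omega, by rwa [Function.iterate_succ_apply]⟩
    · intro h m
      obtain ⟨n, hn, e⟩ := h (m + 1)
      obtain ⟨n, rfl⟩ : ∃ j, n = j + 1 := ⟨n - 1, by omega⟩
      exact ⟨n, by omega, by rwa [Function.iterate_succ_apply] at e⟩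
  have hne : ∀ x, (S x).Nonempty := by
    intro x
    have := (hfin x).to_subtype
    obtain ⟨a, ha⟩ := Finite.exists_infinite_fiber (Set.rangeFactorization fun n : ℕ => f^[n] x)
    refine ⟨a.1, Nat.frequently_atTop_iff_infinite.2 ?_⟩
    convert Set.infinite_coe_iff.1 ha using 1
    ext n
    simp [Set.rangeFactorization, Subtype.ext_iff]
  let g : Set A → A → A := fun T x => if h : T.Nonempty then h.some else x
  let c : A → A := fun x => (hne x).some
  have hc : ∀ x, c (f x) = c x := by
    intro x
    simp only [c, hS]
  have hex : ∀ x, ∃ n, f^[n] x = c x := fun x => (hne x).some_mem.exists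
  let h : A → ℕ := fun x => Nat.find (hex x)
  have h0 : ∀ x, h x = 0 ↔ x = c x := fun x => by simp [h]
  have hs : ∀ x, h x ≠ 0 → h x = h (f x) + 1 := by
    intro x hx
    refine le_antisymm (Nat.find_min' _ ?_) ?_
    · rw [Function.iterate_succ_apply, ← hc x]
      exact Nat.find_spec (hex (f x))
    · have e : f^[h x] x = c x := Nat.find_spec (hex x)
      obtain ⟨n, hn⟩ : ∃ j, h x = j + 1 := ⟨h x - 1, by omega⟩
      rw [hn, Function.iterate_succ_apply, ← hc x] at e
      have : h (f x) ≤ n := Nat.find_min' _ e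
      omega
  refine ⟨fun x => if h x = 0 then 2 else if h x % 2 = 0 then 0 else 1, fun x hx => ?_⟩
  by_cases hx0 : h x = 0
  · have : h (f x) ≠ 0 := by
      intro h1
      rw [h0] at hx0 h1
      exact hx (by rw [h1, hc, ← hx0])
    simp only [hx0, this, if_true, if_false]
    split_ifs <;> decide
  · have := hs x hx0
    simp only [hx0, if_false]
    split_ifs <;> first | decide | omega

theorem Int.log_natCast_mul {k : ℕ} (hk : 1 < k) {r : ℚ} (hr : 0 < r) :
    Int.log k (k * r) = Int.log k r + 1 := by
  have hk0 : (0 : ℚ) < k := by positivity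
  have hkr : 0 < (k : ℚ) * r := by positivity
  refine le_antisymm (Int.lt_add_one_iff.1 ?_) ?_
  · rw [← Int.lt_zpow_iff_log_lt hk hkr, zpow_add_one₀ hk0.ne', mul_comm]
    exact mul_lt_mul_of_pos_right (Int.lt_zpow_succ_log_self hk r) hk0
  · rw [← Int.zpow_le_iff_le_log hk hkr, zpow_add_one₀ hk0.ne', mul_comm]
    exact mul_le_mul_of_nonneg_left (Int.zpow_log_le_self hk hr) hk0.le

theorem exists_two_colouring_mul {k : ℕ} (hk : 1 < k) :
    ∃ χ : ℚ → Fin 2, ∀ a ≠ 0, χ a ≠ χ (k * a) := by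
  refine ⟨fun a => if Int.log k |a| % 2 = 0 then 0 else 1, fun a ha => ?_⟩
  have := Int.log_natCast_mul hk (abs_pos.2 ha)
  simp only [abs_mul, Nat.abs_cast, this]
  split_ifs <;> first | decide | omega

/-- Infinite sets contain an infinite subset on which a map to a well-order is either constant
or has finite initial segments. -/
theorem Set.Infinite.exists_subset_const_or_finite_le {A ι : Type*} [LinearOrder ι]
    [WellFoundedLT ι] (f : A → ι) {X : Set A} (hX : X.Infinite) :
    ∃ Y ⊆ X, Y.Infinite ∧ ((∃ M, ∀ x ∈ Y, f x = M) ∨ ∀ x ∈ Y, {y ∈ Y | f y ≤ f x}.Finite) := by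
  by_cases h : ∃ M, {x ∈ X | f x ≤ M}.Infinite
  · obtain ⟨M, hM, hmin⟩ := WellFounded.has_min (wellFounded_lt (α := ι))
      {M | {x ∈ X | f x ≤ M}.Infinite} h
    by_cases hlt : {x ∈ X | f x < M}.Infinite
    · refine ⟨_, Set.sep_subset _ _, hlt, Or.inr fun x hx => ?_⟩
      by_contra hinf
      exact hmin (f x) (Set.Infinite.mono (fun y hy => ⟨hy.1.1, hy.2⟩) hinf) hx.2
    · refine ⟨{x ∈ X | f x = M}, Set.sep_subset _ _, fun hfin => hM ?_,
        Or.inl ⟨M, fun x hx => hx.2⟩⟩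
      refine ((Set.not_infinite.1 hlt).union hfin).subset fun x hx => ?_
      rcases hx.2.lt_or_eq with h | h
      · exact Or.inl ⟨hx.1, h⟩
      · exact Or.inr ⟨hx.1, h⟩
  · push Not at h
    exact ⟨X, subset_rfl, hX, Or.inr fun x _ => h (f x)⟩

theorem Set.Infinite.exists_finset_card_add_one {A : Type*} {k : ℕ} (hk : 1 < k) {X : Set A}
    (hX : X.Infinite) : ∃ F : Finset A, ↑F ⊆ X ∧ F.card + 1 = k := by
  obtain ⟨F, hF, hc⟩ := hX.exists_subset_card_eq (k - 1)
  exact ⟨F, hF, by omega⟩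

theorem Finsupp.exists_leading_index (ι : Type*) [LinearOrder ι] [Nonempty ι] :
    ∃ m : (ι →₀ ℚ) → ι, (∀ x ≠ 0, x (m x) ≠ 0 ∧ ∀ j, m x < j → x j = 0) ∧
      ∀ x M, x M ≠ 0 → (∀ j, M < j → x j = 0) → m x = M := by
  classical
  have key : ∀ x : ι →₀ ℚ, ∃ i, x ≠ 0 → x i ≠ 0 ∧ ∀ j, i < j → x j = 0 := by
    intro x
    by_cases hx : x = 0
    · exact ⟨Classical.arbitrary ι, fun h => (h hx).elim⟩
    · have hs : x.support.Nonempty := Finsupp.support_nonempty_iff.2 hx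
      refine ⟨x.support.max' hs, fun _ =>
        ⟨Finsupp.mem_support_iff.1 (x.support.max'_mem hs), fun j hj => ?_⟩⟩
      by_contra hne
      exact absurd (x.support.le_max' j (Finsupp.mem_support_iff.2 hne)) (not_le.2 hj)
  choose m hm using key
  refine ⟨m, hm, fun x M hM hj => ?_⟩
  have hx : x ≠ 0 := by
    rintro rfl
    exact hM rfl
  obtain ⟨h1, h2⟩ := hm x hx
  rcases lt_trichotomy (m x) M with h | h | h
  · exact (hM (h2 M h)).elim
  · exact h
  · exact (h1 (hj _ h)).elim

theorem Set.Infinite.exists_subset_same_sign {A : Type*} {X : Set A} (hX : X.Infinite)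
    (a : A → ℚ) (ha : ∀ x ∈ X, a x ≠ 0) :
    ∃ Y ⊆ X, Y.Infinite ∧ ((∀ x ∈ Y, 0 < a x) ∨ ∀ x ∈ Y, a x < 0) := by
  by_cases h : {x ∈ X | 0 < a x}.Infinite
  · exact ⟨_, Set.sep_subset _ _, h, Or.inl fun x hx => hx.2⟩
  · refine ⟨{x ∈ X | a x < 0}, Set.sep_subset _ _, fun hfin => hX ?_, Or.inr fun x hx => hx.2⟩
    refine ((Set.not_infinite.1 h).union hfin).subset fun x hx => ?_
    rcases (ha x hx).lt_or_gt with h | h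
    · exact Or.inr ⟨hx, h⟩
    · exact Or.inl ⟨hx, h⟩

theorem add_sum_ne_zero_of_same_sign {A : Type*} {Y : Set A} {a : A → ℚ}
    (h : (∀ x ∈ Y, 0 < a x) ∨ ∀ x ∈ Y, a x < 0) {F : Finset A} (hF : ↑F ⊆ Y) {y : A}
    (hy : y ∈ Y) : a y + ∑ x ∈ F, a x ≠ 0 := by
  rcases h with h | h
  · exact (add_pos_of_pos_of_nonneg (h y hy) (Finset.sum_nonneg fun x hx => (h x (hF hx)).le)).ne'
  · exact (add_neg_of_neg_of_nonpos (h y hy) (Finset.sum_nonpos fun x hx => (h x (hF hx)).le)).ne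

/-- Colour a vector by restricting it to the initial segment below its leading index, and
by a colour of its leading coefficient. -/
theorem SeparatesSums.exists_of_forall_Iic {ι : Type*} [LinearOrder ι] [WellFoundedLT ι]
    [Nonempty ι] {k : ℕ} (hk : 1 < k) {C : Type*}
    (h : ∀ M : ι, ∃ c : (Set.Iic M →₀ ℚ) → C, SeparatesSums k c) :
    ∃ c : (ι →₀ ℚ) → C × Fin 2, SeparatesSums k c := by
  classical
  choose c hc using h
  obtain ⟨m, hm, huniq⟩ := Finsupp.exists_leading_index ι
  obtain ⟨χ, hχ⟩ := exists_two_colouring_mul hk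
  have hk0 : (k : ℚ) ≠ 0 := by positivity
  have hsmul : ∀ x : ι →₀ ℚ, x ≠ 0 → m (k • x) = m x := by
    intro x hx
    obtain ⟨h1, h2⟩ := hm x hx
    refine huniq _ _ ?_ fun j hj => ?_
    · simpa using ⟨by omega, h1⟩
    · simp [h2 j hj]
  refine ⟨fun x => (c (m x) (x.subtypeDomain (· ∈ Set.Iic (m x))), χ (x (m x))), fun X hX => ?_⟩
  have hX' : (X \ {0}).Infinite := hX.sdiff (Set.finite_singleton 0)
  obtain ⟨Y, hYX, hY, ⟨M, hM⟩ | hlt⟩ := hX'.exists_subset_const_or_finite_le m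
  · have hne : ∀ x ∈ Y, x ≠ 0 := fun x hx => (hYX hx).2
    obtain ⟨Z, hZY, hZ, hsign⟩ := hY.exists_subset_same_sign (fun x => x M) fun x hx => by
      rw [← hM x hx]
      exact (hm x (hne x hx)).1
    have htop : ∀ x ∈ Z, ∀ j, M < j → x j = 0 := fun x hx j hj =>
      (hm x (hne x (hZY hx))).2 j (by rwa [hM x (hZY hx)])
    let res : (ι →₀ ℚ) →+ (Set.Iic M →₀ ℚ) :=
      Finsupp.subtypeDomainAddMonoidHom (p := (· ∈ Set.Iic M))
    have hinj : Set.InjOn res Z := by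
      intro x hx x' hx' e
      ext j
      by_cases hj : j ≤ M
      · exact DFunLike.congr_fun e ⟨j, hj⟩
      · rw [htop x hx j (not_le.1 hj), htop x' hx' j (not_le.1 hj)]
    obtain ⟨F', hF', hcard, y', ⟨y, hy, rfl⟩, hyF, hcol⟩ := hc M (res '' Z) (hZ.image hinj)
    obtain ⟨F, hFZ, rfl⟩ := Finset.subset_set_image_iff.1 hF'
    have hinjF : Set.InjOn res F := hinj.mono hFZ
    rw [Finset.card_image_of_injOn hinjF] at hcard
    rw [Finset.sum_image hinjF, ← map_sum, ← map_add, ← map_nsmul] at hcol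
    refine ⟨F, (hFZ.trans hZY).trans (hYX.trans Set.sdiff_subset), hcard, y,
      (hYX (hZY hy)).1, fun hmem => hyF (Finset.mem_image_of_mem _ hmem), fun e => hcol ?_⟩
    have e1 : m (y + ∑ x ∈ F, x) = M := by
      refine huniq _ _ ?_ fun j hj => ?_
      · simpa [Finsupp.finsetSum_apply] using add_sum_ne_zero_of_same_sign hsign hFZ hy
      · rw [Finsupp.add_apply, Finsupp.finsetSum_apply, htop y hy j hj, zero_add]
        exact Finset.sum_eq_zero fun x hx => htop x (hFZ hx) j hj
    have e2 : m (k • y) = M := (hsmul y (hne y (hZY hy))).trans (hM y (hZY hy))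
    have e3 := congrArg Prod.fst e
    simp only at e3
    rw [e1, e2] at e3
    exact e3
  · obtain ⟨F, hFY, hF⟩ := hY.exists_finset_card_add_one hk
    have hfin : (⋃ x ∈ F, {y ∈ Y | m y ≤ m x}).Finite :=
      F.finite_toSet.biUnion fun x hx => hlt x (hFY hx)
    obtain ⟨y, hy, hyn⟩ := (hY.sdiff hfin).nonempty
    have hgt : ∀ x ∈ F, m x < m y := by
      intro x hx
      by_contra hle
      exact hyn (Set.mem_biUnion (x := x) hx ⟨hy, not_lt.1 hle⟩)
    have hy0 : y ≠ 0 := (hYX hy).2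
    obtain ⟨hlead, htop⟩ := hm y hy0
    refine ⟨F, hFY.trans (hYX.trans Set.sdiff_subset), hF, y, (hYX hy).1,
      fun hmem => lt_irrefl _ (hgt y hmem), fun e => ?_⟩
    have hsum : ∀ j, m y ≤ j → (y + ∑ x ∈ F, x) j = y j := by
      intro j hj
      rw [Finsupp.add_apply, Finsupp.finsetSum_apply, Finset.sum_eq_zero, add_zero]
      exact fun x hx => (hm x (hYX (hFY hx)).2).2 j ((hgt x hx).trans_le hj)
    have e1 : m (y + ∑ x ∈ F, x) = m y := by
      refine huniq _ _ ?_ fun j hj => ?_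
      · rwa [hsum _ le_rfl]
      · rw [hsum _ hj.le, htop j hj]
    have e2 := congrArg Prod.snd e
    simp only at e2
    rw [e1, hsmul y hy0, hsum _ le_rfl, Finsupp.smul_apply, nsmul_eq_mul] at e2
    exact hχ _ hlead e2

/-- A colouring by the level of a filtration, refined by a colouring of the quotients. -/
theorem exists_colouring_of_filtration {A : Type*} [AddCommGroup A] {k : ℕ} {H : ℕ → AddSubgroup A}
    (hmono : Monotone H) (hex : ∀ x, ∃ j, x ∈ H j) (hk : ∀ j x, k • x ∈ H j → x ∈ H (j + 1))
    (hk' : ∀ j x, k • x - x ∈ H j → x ∈ H (j + 1)) (htor : ∀ x, ∃ n, 0 < n ∧ n • x ∈ H 0) :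
    ∃ c : A → Fin 2 × Fin 3, ∀ R, ∀ s ∈ H R, ∀ y ∉ H (R + 2), c (y + s) ≠ c (k • y) := by
  classical
  have hcol : ∀ j, ∃ col : A ⧸ H j → Fin 3, ∀ x, k • x ≠ x → col x ≠ col (k • x) := by
    intro j
    refine exists_three_colouring (fun x : A ⧸ H j => k • x) fun x => ?_
    induction x using QuotientAddGroup.induction_on with
    | H x =>
      obtain ⟨n, hn, hx⟩ := htor x
      have hfin : IsOfFinAddOrder (x : A ⧸ H j) := by
        refine isOfFinAddOrder_iff_nsmul_eq_zero.2 ⟨n, hn, ?_⟩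
        rw [← QuotientAddGroup.mk_nsmul, QuotientAddGroup.eq_zero_iff]
        exact hmono (Nat.zero_le j) hx
      refine hfin.finite_multiples.subset ?_
      rintro _ ⟨m, rfl⟩
      refine ⟨k ^ m, ?_⟩
      simp [smul_iterate]
  choose col hcol using hcol
  let r : A → ℕ := fun x => Nat.find (hex x)
  have hr : ∀ x j, r x ≤ j ↔ x ∈ H j := fun x j =>
    ⟨fun h => hmono h (Nat.find_spec (hex x)), fun h => Nat.find_min' _ h⟩
  let q : ℕ → A → Fin 3 := fun j x => col j x
  refine ⟨fun x => (if r x % 2 = 0 then 0 else 1, q (r x - 2) x), fun R s hs y hy e => ?_⟩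
  have hry : R + 3 ≤ r y := by
    by_contra hlt
    exact hy ((hr y (R + 2)).1 (by omega))
  have hmem : ∀ j, R ≤ j → (y + s ∈ H j ↔ y ∈ H j) := fun j hj =>
    (H j).add_mem_cancel_right (hmono hj hs)
  have hrs : r (y + s) = r y := by
    have h1 : r (y + s) ≤ r y := (hr _ _).2 ((hmem _ (by omega)).2 ((hr _ _).1 le_rfl))
    have h2 : r y ≤ max R (r (y + s)) :=
      (hr _ _).2 ((hmem _ (le_max_left _ _)).1 ((hr _ _).1 (le_max_right _ _)))
    omega
  have hrk : r (k • y) ≤ r y := (hr _ _).2 ((H _).nsmul_mem ((hr _ _).1 le_rfl) k)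
  have hrk' : r y ≤ r (k • y) + 1 := (hr _ _).2 (hk _ _ ((hr _ _).1 le_rfl))
  simp only [hrs, Prod.mk.injEq] at e
  obtain ⟨e1, e2⟩ := e
  have hreq : r (k • y) = r y := by
    by_contra hne
    split_ifs at e1 <;> omega
  rw [hreq] at e2
  simp only [q] at e2
  have hmk : ((y + s : A) : A ⧸ H (r y - 2)) = y := by
    rw [QuotientAddGroup.mk_add, (QuotientAddGroup.eq_zero_iff s).2 (hmono (by omega) hs), add_zero]
  rw [hmk, QuotientAddGroup.mk_nsmul] at e2
  refine hcol _ _ (fun hfix => ?_) e2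
  have : k • y - y ∈ H (r y - 2) := by
    rw [← QuotientAddGroup.eq_zero_iff, QuotientAddGroup.mk_sub, QuotientAddGroup.mk_nsmul, hfix,
      sub_self]
  have := (hr _ _).2 (hk' _ _ this)
  omega

/-- The vectors whose entries are integer multiples of `1 / d`. -/
def fractionLattice (ι : Type*) (d : ℕ) : AddSubgroup (ι →₀ ℚ) where
  carrier := {x | ∀ i, (d : ℚ) * x i ∈ (Int.castAddHom ℚ).range}
  zero_mem' i := by simp
  add_mem' hx hy i := by
    rw [Finsupp.add_apply, mul_add]
    exact add_mem (hx i) (hy i)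
  neg_mem' hx i := by
    rw [Finsupp.neg_apply, mul_neg]
    exact neg_mem (hx i)

theorem mem_fractionLattice {ι : Type*} {d : ℕ} {x : ι →₀ ℚ} :
    x ∈ fractionLattice ι d ↔ ∀ i, ∃ z : ℤ, (z : ℚ) = d * x i :=
  Iff.rfl

theorem fractionLattice_mono {ι : Type*} {d e : ℕ} (h : d ∣ e) :
    fractionLattice ι d ≤ fractionLattice ι e := by
  obtain ⟨a, rfl⟩ := h
  intro x hx i
  obtain ⟨z, hz⟩ := hx i
  refine ⟨a * z, ?_⟩
  simp only [Int.coe_castAddHom] at hz ⊢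
  push_cast
  rw [hz]
  ring

theorem mem_fractionLattice_of_nsmul_mem {ι : Type*} {d a : ℕ} {x : ι →₀ ℚ}
    (h : a • x ∈ fractionLattice ι d) : x ∈ fractionLattice ι (d * a) := by
  intro i
  obtain ⟨z, hz⟩ := h i
  refine ⟨z, hz.trans ?_⟩
  simp [mul_assoc]

theorem exists_mem_fractionLattice {ι : Type*} (x : ι →₀ ℚ) :
    ∃ d, 0 < d ∧ x ∈ fractionLattice ι d := by
  refine ⟨∏ i ∈ x.support, (x i).den, Finset.prod_pos fun i _ => (x i).den_pos, fun i => ?_⟩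
  by_cases hi : i ∈ x.support
  · obtain ⟨a, ha⟩ := Finset.dvd_prod_of_mem (fun i => (x i).den) hi
    refine ⟨a * (x i).num, ?_⟩
    rw [ha]
    simp only [Int.coe_castAddHom]
    push_cast
    rw [← Rat.mul_den_eq_num (x i)]
    ring
  · exact ⟨0, by simp [Finsupp.notMem_support_iff.1 hi]⟩

theorem finite_fractionLattice_bounded {ι : Type*} [Fintype ι] {d : ℕ} (hd : 0 < d) (C : ℚ) :
    {x | x ∈ fractionLattice ι d ∧ ∑ i, |x i| ≤ C}.Finite := by
  have hd' : (0 : ℚ) < d := by exact_mod_cast hd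
  refine ((Set.Finite.pi' fun _ : ι => Set.finite_Icc (-⌈d * C⌉) ⌈d * C⌉).image
    fun g => Finsupp.equivFunOnFinite.symm fun i => (g i : ℚ) / d).subset ?_
  rintro x ⟨hx, hC⟩
  choose z hz using mem_fractionLattice.1 hx
  refine ⟨z, fun i => ?_, ?_⟩
  · have h1 : |x i| ≤ C :=
      (Finset.single_le_sum (fun j _ => abs_nonneg (x j)) (Finset.mem_univ i)).trans hC
    have h2 : |(z i : ℚ)| ≤ (⌈d * C⌉ : ℤ) := by
      rw [hz, abs_mul, abs_of_pos hd']
      exact (mul_le_mul_of_nonneg_left h1 hd'.le).trans (Int.le_ceil _)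
    exact abs_le.1 (by exact_mod_cast h2)
  · ext i
    simp [hz, hd'.ne']

theorem exists_colouring_of_unbounded (ι : Type*) [Fintype ι] {k : ℕ} (hk : 1 < k) :
    ∃ c : (ι →₀ ℚ) → Fin 4, ∀ X : Set (ι →₀ ℚ), (∀ C : ℚ, ∃ x ∈ X, C < ∑ i, |x i|) →
      ∀ F : Finset (ι →₀ ℚ), ∃ y ∈ X, y ∉ F ∧ c (y + ∑ x ∈ F, x) ≠ c (k • y) := by
  classical
  let N : (ι →₀ ℚ) → ℚ := fun x => ∑ i, |x i|
  have hN0 : ∀ x, 0 ≤ N x := fun x => Finset.sum_nonneg fun i _ => abs_nonneg _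
  have hadd : ∀ x y, N (x + y) ≤ N x + N y := fun x y => by
    simp only [N, ← Finset.sum_add_distrib]
    exact Finset.sum_le_sum fun i _ => abs_add_le _ _
  have hneg : ∀ x, N (-x) = N x := fun x => by simp [N]
  have hsmul : ∀ x, N (k • x) = k * N x := fun x => by simp [N, abs_mul, Finset.mul_sum]
  refine ⟨fun x => ⟨(Int.log k (N x ^ 2) % 4).toNat, by omega⟩, fun X hX F => ?_⟩
  obtain ⟨y, hyX, hy⟩ := hX (10 * N (∑ x ∈ F, x) + ∑ x ∈ F, N x)
  change _ < N y at hy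
  have hsum : 0 ≤ ∑ x ∈ F, N x := Finset.sum_nonneg fun x _ => hN0 x
  refine ⟨y, hyX, fun hmem => ?_, fun e => ?_⟩
  · have := Finset.single_le_sum (fun x _ => hN0 x) hmem
    linarith [hN0 (∑ x ∈ F, x)]
  · set s := ∑ x ∈ F, x
    have hs := hN0 s
    have h1 : N (y + s) ≤ N y + N s := hadd y s
    have h2 : N y ≤ N (y + s) + N s := by
      have := hadd (y + s) (-s)
      rwa [add_neg_cancel_right, hneg] at this
    have hk2 : (2 : ℚ) ≤ k := by exact_mod_cast hk
    have hypos : 0 < N y := by linarith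
    have hyspos : 0 < N (y + s) := by linarith
    have l1 : N (y + s) ^ 2 ≤ k * N y ^ 2 := by nlinarith
    have l2 : N y ^ 2 ≤ k * N (y + s) ^ 2 := by nlinarith
    have i1 := Int.log_mono_right (b := k) (by positivity) l1
    have i2 := Int.log_mono_right (b := k) (by positivity) l2
    rw [Int.log_natCast_mul hk (by positivity)] at i1 i2
    have i3 : Int.log k (N (k • y) ^ 2) = Int.log k (N y ^ 2) + 1 + 1 := by
      rw [← Int.log_natCast_mul hk (by positivity), ← Int.log_natCast_mul hk (by positivity), hsmul]
      congr 1
      ring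
    simp only [Fin.mk.injEq] at e
    omega

theorem exists_colouring_of_bounded (ι : Type*) [Fintype ι] {k : ℕ} (hk : 1 < k) :
    ∃ c : (ι →₀ ℚ) → Fin 2 × Fin 3, ∀ X : Set (ι →₀ ℚ), X.Infinite →
      (∃ C : ℚ, ∀ x ∈ X, ∑ i, |x i| ≤ C) →
      ∀ F : Finset (ι →₀ ℚ), ∃ y ∈ X, y ∉ F ∧ c (y + ∑ x ∈ F, x) ≠ c (k • y) := by
  let d : ℕ → ℕ := fun j => (k * (k - 1)) ^ j * j.factorial
  have hdk : ∀ j, d j * k ∣ d (j + 1) := fun j =>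
    ⟨(k - 1) * (j + 1), by simp only [d, Nat.factorial_succ]; ring⟩
  have hdk' : ∀ j, d j * (k - 1) ∣ d (j + 1) := fun j =>
    ⟨k * (j + 1), by simp only [d, Nat.factorial_succ]; ring⟩
  have hd0 : ∀ j, 0 < d j := fun j =>
    Nat.mul_pos (pow_pos (Nat.mul_pos (by omega) (by omega)) _) j.factorial_pos
  have hmono : Monotone fun j => fractionLattice ι (d j) := monotone_nat_of_le_succ fun j =>
    fractionLattice_mono ((Dvd.intro _ rfl).trans (hdk j))
  have hex : ∀ x, ∃ j, x ∈ fractionLattice ι (d j) := by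
    intro x
    obtain ⟨j, hj, hx⟩ := exists_mem_fractionLattice x
    exact ⟨j, fractionLattice_mono ((Nat.dvd_factorial hj le_rfl).trans (Dvd.intro_left _ rfl)) hx⟩
  obtain ⟨c, hc⟩ := exists_colouring_of_filtration (k := k) hmono hex
    (fun j x hx => fractionLattice_mono (hdk j) (mem_fractionLattice_of_nsmul_mem hx))
    (fun j x hx => fractionLattice_mono (hdk' j) (mem_fractionLattice_of_nsmul_mem (by
      rwa [sub_nsmul x hk.le, one_nsmul, ← sub_eq_add_neg])))
    (fun x => by
      obtain ⟨n, hn, hx⟩ := exists_mem_fractionLattice x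
      refine ⟨n, hn, fun i => ?_⟩
      obtain ⟨z, hz⟩ := hx i
      exact ⟨z, by simpa [d] using hz⟩)
  refine ⟨c, fun X hX ⟨C, hC⟩ F => ?_⟩
  obtain ⟨R, hR⟩ := hex (∑ x ∈ F, x)
  have hfin := (finite_fractionLattice_bounded (ι := ι) (hd0 (R + 2)) C).union F.finite_toSet
  obtain ⟨y, hy, hyn⟩ := (hX.sdiff hfin).nonempty
  exact ⟨y, hy, fun hmem => hyn (Or.inr hmem),
    hc R _ hR y fun hmem => hyn (Or.inl ⟨hmem, hC y hy⟩)⟩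

theorem exists_separatesSums_of_finite (ι : Type*) [Finite ι] {k : ℕ} (hk : 1 < k) :
    ∃ c : (ι →₀ ℚ) → Fin 24, SeparatesSums k c := by
  have := Fintype.ofFinite ι
  obtain ⟨c₁, h₁⟩ := exists_colouring_of_unbounded ι hk
  obtain ⟨c₂, h₂⟩ := exists_colouring_of_bounded ι hk
  have hc : SeparatesSums k fun x => (c₁ x, c₂ x) := by
    intro X hX
    obtain ⟨F, hFX, hF⟩ := hX.exists_finset_card_add_one hk
    refine ⟨F, hFX, hF, ?_⟩
    by_cases hb : ∃ C : ℚ, ∀ x ∈ X, ∑ i, |x i| ≤ C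
    · obtain ⟨y, hy, hyF, hne⟩ := h₂ X hX hb F
      exact ⟨y, hy, hyF, fun e => hne (congrArg Prod.snd e)⟩
    · push Not at hb
      obtain ⟨y, hy, hyF, hne⟩ := h₁ X hb F
      exact ⟨y, hy, hyF, fun e => hne (congrArg Prod.fst e)⟩
  exact hc.exists_fin (by simp)

theorem exists_separatesSums_of_lt_aleph {k : ℕ} (hk : 1 < k) (n : ℕ) :
    ∀ (ι : Type*), #ι < aleph n →
      ∃ c : (ι →₀ ℚ) → Fin (24 * 2 ^ n), SeparatesSums k c := by
  induction n with
  | zero =>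
    intro ι hι
    have : Finite ι := by simpa [Cardinal.lt_aleph0_iff_finite] using hι
    simpa using exists_separatesSums_of_finite ι hk
  | succ n ih =>
    intro ι hι
    rcases finite_or_infinite ι with _ | _
    · obtain ⟨c, hc⟩ := exists_separatesSums_of_finite ι hk
      refine hc.exists_fin ?_
      rw [Fintype.card_fin]
      exact Nat.le_mul_of_pos_right _ (by positivity)
    · have hle : #ι ≤ aleph n := by
        rwa [Nat.cast_succ, ← succ_aleph, Order.lt_succ_iff] at hι
      obtain ⟨_, _, ho⟩ := Cardinal.exists_ord_eq_type_lt ι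
      obtain ⟨c, hc⟩ := SeparatesSums.exists_of_forall_Iic (ι := ι) hk fun M =>
        ih (Set.Iic M) ((Cardinal.mk_Iic_lt M ho (Cardinal.aleph0_le_mk ι)).trans_le hle)
      refine hc.exists_fin ?_
      simp [pow_succ, mul_assoc]

theorem stmt_7 (k : ℕ) (hk : 2 ≤ k) (n : ℕ) :
    ∃ c : G (aleph n) → Fin (2 ^ (4 + n) * 3 ^ 2),
      ¬ ∃ X : Set (G (aleph n)), X.Infinite ∧
        ∃ i, ∀ y ∈ FS k X ∪ (fun x => k • x) '' X, c y = i := by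
  obtain ⟨c, hc⟩ := exists_separatesSums_of_lt_aleph hk (n + 1) (aleph n).out (by
    rw [mk_out]
    exact aleph_lt_aleph.2 (by exact_mod_cast Nat.lt_succ_self n))
  obtain ⟨c', hc'⟩ := hc.exists_fin (N := 2 ^ (4 + n) * 3 ^ 2) (by
    rw [Fintype.card_fin, pow_succ, pow_add]
    have := Nat.two_pow_pos n
    omega)
  exact ⟨c', hc'.not_exists_monochromatic⟩
end
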